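/- arXiv:1508.01052 — 3 statements merged into one kernel-verified Lean document; each statement's English description precedes it below -/
import Mathlib

section
/- Let (M, ≤) be a nonempty partially ordered set, X_c ⊆ M an antichain, and let 𝒳 be the set of all partial foliations of M that have a slice containing X_c, partially ordered by ⊑. Then every nonempty totally ordered subset of (𝒳, ⊑) has an upper bound in 𝒳. -/
/-- `SlicePrec X Y`: some element of `X` is strictly below some element of `Y`,
and no element of `Y` is `≤` any element of `X`. -/
def SlicePrec {M : Type} [PartialOrder M] (X Y : Set M) : Prop :=
  (∃ x ∈ X, ∃ y ∈ Y, x < y) ∧ ∀ z ∈ X, ∀ t ∈ Y, ¬ t ≤ z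

/-- A partial foliation of a poset `M`: a collection of pairwise disjoint nonempty
antichains (slices) such that any two distinct slices satisfy exactly one of
`SlicePrec X Y`, `SlicePrec Y X`. -/
def IsPartialFoliation {M : Type} [PartialOrder M] (F : Set (Set M)) : Prop :=
  (∀ X ∈ F, X.Nonempty) ∧
  (∀ X ∈ F, IsAntichain (· ≤ ·) X) ∧
  (F.Pairwise fun X Y => Disjoint X Y) ∧
  (F.Pairwise fun X Y => Xor' (SlicePrec X Y) (SlicePrec Y X))

/-- `FolLE F₁ F₂`: every slice of `F₁` is contained in some slice of `F₂`. -/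
def FolLE {M : Type} [PartialOrder M] (F₁ F₂ : Set (Set M)) : Prop :=
  ∀ X ∈ F₁, ∃ Y ∈ F₂, X ⊆ Y

/-- Two points are related when they lie in a common slice of some member of `𝒴`. -/
def SameSlice {M : Type} (𝒴 : Set (Set (Set M))) (x y : M) : Prop :=
  ∃ F ∈ 𝒴, ∃ X ∈ F, x ∈ X ∧ y ∈ X

theorem SameSlice.symm {M : Type} {𝒴 : Set (Set (Set M))} {x y : M}
    (h : SameSlice 𝒴 x y) : SameSlice 𝒴 y x := by
  obtain ⟨F, hF, X, hX, hx, hy⟩ := h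
  exact ⟨F, hF, X, hX, hy, hx⟩

/-- In a chain, two relations `SameSlice` are witnessed by a single member of the chain. -/
theorem SameSlice.exists_common {M : Type} [PartialOrder M] {𝒴 : Set (Set (Set M))}
    (hchain : ∀ F ∈ 𝒴, ∀ G ∈ 𝒴, FolLE F G ∨ FolLE G F) {a b c d : M}
    (hab : SameSlice 𝒴 a b) (hcd : SameSlice 𝒴 c d) :
    ∃ G ∈ 𝒴, ∃ X ∈ G, ∃ Y ∈ G, a ∈ X ∧ b ∈ X ∧ c ∈ Y ∧ d ∈ Y := by
  obtain ⟨F, hF, X, hX, ha, hb⟩ := hab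
  obtain ⟨G, hG, Y, hY, hc, hd⟩ := hcd
  rcases hchain F hF G hG with h | h
  · obtain ⟨X', hX', hXX'⟩ := h X hX
    exact ⟨G, hG, X', hX', Y, hY, hXX' ha, hXX' hb, hc, hd⟩
  · obtain ⟨Y', hY', hYY'⟩ := h Y hY
    exact ⟨F, hF, X, hX, Y', hY', ha, hb, hYY' hc, hYY' hd⟩

theorem SameSlice.trans {M : Type} [PartialOrder M] {𝒴 : Set (Set (Set M))}
    (hfol : ∀ F ∈ 𝒴, IsPartialFoliation F)
    (hchain : ∀ F ∈ 𝒴, ∀ G ∈ 𝒴, FolLE F G ∨ FolLE G F) {x y z : M}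
    (hxy : SameSlice 𝒴 x y) (hyz : SameSlice 𝒴 y z) : SameSlice 𝒴 x z := by
  obtain ⟨G, hG, X, hX, Y, hY, hx, hyX, hyY, hz⟩ := hxy.exists_common hchain hyz
  obtain rfl : X = Y := by
    by_contra hne
    exact Set.disjoint_left.1 ((hfol G hG).2.2.1 hX hY hne) hyX hyY
  exact ⟨G, hG, X, hX, hx, hz⟩

/-- If `x < y` lie in different classes, the class of `x` precedes the class of `y`. -/
theorem slicePrec_sameSlice_of_lt {M : Type} [PartialOrder M] {𝒴 : Set (Set (Set M))}
    (hfol : ∀ F ∈ 𝒴, IsPartialFoliation F)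
    (hchain : ∀ F ∈ 𝒴, ∀ G ∈ 𝒴, FolLE F G ∨ FolLE G F) {a b x y : M}
    (hax : SameSlice 𝒴 a x) (hby : SameSlice 𝒴 b y) (hxy : x < y) (hab : ¬ SameSlice 𝒴 a b) :
    SlicePrec {z | SameSlice 𝒴 a z} {t | SameSlice 𝒴 b t} := by
  refine ⟨⟨x, hax, y, hby, hxy⟩, fun z hz t ht htz => ?_⟩
  obtain ⟨G, hG, X, hX, Y, hY, hx, hzX, hy, htY⟩ :=
    (hax.symm.trans hfol hchain hz).exists_common hchain (hby.symm.trans hfol hchain ht)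
  have hne : X ≠ Y := by
    rintro rfl
    exact hab ((hax.trans hfol hchain ⟨G, hG, X, hX, hx, hy⟩).trans hfol hchain hby.symm)
  rcases (hfol G hG).2.2.2 hX hY hne with ⟨h, -⟩ | ⟨h, -⟩
  · exact h.2 z hzX t htY htz
  · exact h.2 y hy x hx hxy.le

/-- The classes of `SameSlice` for a chain of partial foliations form a partial foliation. -/
theorem isPartialFoliation_sameSlice {M : Type} [PartialOrder M] {𝒴 : Set (Set (Set M))}
    (hfol : ∀ F ∈ 𝒴, IsPartialFoliation F)
    (hchain : ∀ F ∈ 𝒴, ∀ G ∈ 𝒴, FolLE F G ∨ FolLE G F) :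
    IsPartialFoliation {A | ∃ a, SameSlice 𝒴 a a ∧ A = {z | SameSlice 𝒴 a z}} := by
  have eq_of_rel : ∀ {a b : M}, SameSlice 𝒴 a b →
      {z | SameSlice 𝒴 a z} = {z | SameSlice 𝒴 b z} := fun {a b} h =>
    Set.ext fun z => ⟨fun hz => h.symm.trans hfol hchain hz, fun hz => h.trans hfol hchain hz⟩
  refine ⟨?_, ?_, ?_, ?_⟩
  · rintro _ ⟨a, ha, rfl⟩
    exact ⟨a, ha⟩
  · rintro _ ⟨a, -, rfl⟩ y hy z hz hyz hle
    obtain ⟨F, hF, X, hX, hyX, hzX⟩ := SameSlice.trans hfol hchain (SameSlice.symm hy) hz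
    exact (hfol F hF).2.1 X hX hyX hzX hyz hle
  · rintro _ ⟨a, -, rfl⟩ _ ⟨b, -, rfl⟩ hne
    exact Set.disjoint_left.2 fun z hz hz' =>
      hne (eq_of_rel (SameSlice.trans hfol hchain hz (SameSlice.symm hz')))
  · rintro _ ⟨a, ha, rfl⟩ _ ⟨b, hb, rfl⟩ hne
    have hab : ¬ SameSlice 𝒴 a b := fun h => hne (eq_of_rel h)
    obtain ⟨G, hG, X, hX, Y, hY, haX, -, hbY, -⟩ := ha.exists_common hchain hb
    have hXY : X ≠ Y := by
      rintro rfl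
      exact hab ⟨G, hG, X, hX, haX, hbY⟩
    rcases (hfol G hG).2.2.2 hX hY hXY with
      ⟨⟨⟨x, hx, y, hy, hxy⟩, -⟩, -⟩ | ⟨⟨⟨y, hy, x, hx, hyx⟩, -⟩, -⟩
    all_goals
      have hax : SameSlice 𝒴 a x := ⟨G, hG, X, hX, haX, hx⟩
      have hby : SameSlice 𝒴 b y := ⟨G, hG, Y, hY, hbY, hy⟩
    · exact Or.inl ⟨slicePrec_sameSlice_of_lt hfol hchain hax hby hxy hab,
        fun h => h.2 y hby x hax hxy.le⟩
    · exact Or.inr ⟨slicePrec_sameSlice_of_lt hfol hchain hby hax hyx fun h => hab h.symm,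
        fun h => h.2 x hax y hby hyx.le⟩

/-- In the set `𝒳` of partial foliations having a slice containing a given antichain
`Xc`, ordered by `FolLE`, every nonempty totally ordered subset has an upper bound
in `𝒳`. -/
theorem chain_of_partial_foliations_has_upper_bound
    {M : Type} [PartialOrder M] [Nonempty M]
    (Xc : Set M) (hXc : IsAntichain (· ≤ ·) Xc)
    (𝒴 : Set (Set (Set M)))
    (h𝒴 : ∀ F ∈ 𝒴, IsPartialFoliation F ∧ ∃ X ∈ F, Xc ⊆ X)
    (hne : 𝒴.Nonempty)
    (hchain : ∀ F ∈ 𝒴, ∀ G ∈ 𝒴, FolLE F G ∨ FolLE G F) :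
    ∃ Fsup : Set (Set M), (IsPartialFoliation Fsup ∧ ∃ X ∈ Fsup, Xc ⊆ X) ∧
      ∀ F ∈ 𝒴, FolLE F Fsup := by
  have hub : ∀ F ∈ 𝒴, FolLE F {A | ∃ a, SameSlice 𝒴 a a ∧ A = {z | SameSlice 𝒴 a z}} := by
    intro F hF X hX
    obtain ⟨x, hx⟩ := (h𝒴 F hF).1.1 X hX
    exact ⟨_, ⟨x, ⟨F, hF, X, hX, hx, hx⟩, rfl⟩, fun y hy => ⟨F, hF, X, hX, hx, hy⟩⟩
  refine ⟨_, ⟨isPartialFoliation_sameSlice (fun F hF => (h𝒴 F hF).1) hchain, ?_⟩, hub⟩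
  obtain ⟨F, hF⟩ := hne
  obtain ⟨X, hX, hXcX⟩ := (h𝒴 F hF).2
  obtain ⟨Y, hY, hXY⟩ := hub F hF X hX
  exact ⟨Y, hY, hXcX.trans hXY⟩
end

section
/- Let (M, ≤) be a partially ordered set, F a partial foliation of M, and x ∈ M an element that is incomparable to every element of every slice of F. Then for any slice X ∈ F, the collection F' obtained from F by replacing X with X ∪ {x} is a partial foliation of M with F ⊑ F' and F ≠ F'. -/
/-- Adjoining to `X` a point incomparable to all of `Y` does not change `SlicePrec X Y`. -/
theorem slicePrec_insert_left {M : Type} [PartialOrder M] {x : M} {X Y : Set M}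
    (h : ∀ y ∈ Y, ¬ x ≤ y ∧ ¬ y ≤ x) : SlicePrec (insert x X) Y ↔ SlicePrec X Y := by
  have hlt : ¬ ∃ y ∈ Y, x < y := fun ⟨y, hy, hxy⟩ => (h y hy).1 hxy.le
  have hle : ∀ t ∈ Y, ¬ t ≤ x := fun t ht => (h t ht).2
  simp only [SlicePrec, Set.exists_mem_insert, Set.forall_mem_insert]
  grind

/-- Adjoining to `X` a point incomparable to all of `Y` does not change `SlicePrec Y X`. -/
theorem slicePrec_insert_right {M : Type} [PartialOrder M] {x : M} {X Y : Set M}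
    (h : ∀ y ∈ Y, ¬ x ≤ y ∧ ¬ y ≤ x) : SlicePrec Y (insert x X) ↔ SlicePrec Y X := by
  have hlt : ∀ y ∈ Y, ¬ y < x := fun y hy hyx => (h y hy).2 hyx.le
  have hle : ∀ z ∈ Y, ¬ x ≤ z := fun z hz => (h z hz).1
  simp only [SlicePrec, Set.exists_mem_insert, Set.forall_mem_insert]
  grind

/-- If `x` is incomparable to every element of every slice of a partial foliation
`F`, then for any slice `X ∈ F`, replacing `X` by `X ∪ {x}` yields a strictly
larger partial foliation. -/
theorem insert_incomparable_point
    {M : Type} [PartialOrder M]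
    (F : Set (Set M)) (hF : IsPartialFoliation F)
    (x : M) (hx : ∀ X ∈ F, ∀ y ∈ X, ¬ x ≤ y ∧ ¬ y ≤ x)
    (X : Set M) (hX : X ∈ F) :
    IsPartialFoliation (insert (insert x X) (F \ {X})) ∧
    FolLE F (insert (insert x X) (F \ {X})) ∧
    F ≠ insert (insert x X) (F \ {X}) := by
  obtain ⟨hne, hanti, hdisj, hprec⟩ := hF
  have hxmem : ∀ Y ∈ F, x ∉ Y := fun Y hY hxY => (hx Y hY x hxY).1 le_rfl
  refine ⟨⟨?_, ?_, ?_, ?_⟩, ?_, ?_⟩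
  · rintro Y (rfl | hY)
    · exact Set.insert_nonempty x X
    · exact hne Y hY.1
  · rintro Y (rfl | hY)
    · exact (hanti X hX).insert (fun y hy _ => (hx X hX y hy).2) fun y hy _ => (hx X hX y hy).1
    · exact hanti Y hY.1
  · refine (hdisj.mono Set.sdiff_subset).insert_of_symm fun Y hY _ => ?_
    exact Set.disjoint_insert_left.2 ⟨hxmem Y hY.1, hdisj hX hY.1 (Ne.symm hY.2)⟩
  · have : Std.Symm fun X Y : Set M => Xor' (SlicePrec X Y) (SlicePrec Y X) :=
      ⟨fun _ _ h => Or.symm h⟩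
    refine (hprec.mono Set.sdiff_subset).insert_of_symm fun Y hY _ => ?_
    rw [slicePrec_insert_left (hx Y hY.1), slicePrec_insert_right (hx Y hY.1)]
    exact hprec hX hY.1 (Ne.symm hY.2)
  · intro Y hY
    by_cases h : Y = X
    · exact ⟨insert x X, Set.mem_insert _ _, h ▸ Set.subset_insert x Y⟩
    · exact ⟨Y, Set.mem_insert_of_mem _ ⟨hY, h⟩, subset_rfl⟩
  · intro h
    exact hxmem (insert x X) (h ▸ Set.mem_insert _ _) (Set.mem_insert x X)
end

section
/- Let 𝒞 be a well behaved causal set, Φ an automorphism of 𝒞, and x₀ ∈ 𝒞. Let Σ be the set of minimal elements of the set S = {x ∈ 𝒞 : x₀ < x and x ≠ Φ^ℓ(x₀) for every integer ℓ > 0}. Then Σ is a finite antichain. -/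
/-- `Φ` is an automorphism of the ordered set `C`. -/
def IsCausalAuto {C : Type} [PartialOrder C] (Φ : Equiv.Perm C) : Prop :=
  ∀ x y : C, x ≤ y ↔ Φ x ≤ Φ y

/-- A countably infinite, locally finite poset `C` is a *well behaved causal set* if:
(a) every antichain is contained in the union of the pasts and futures of the points
of any maximal chain; (b) for every point `x` and every antichain `A`, both
`Past(x) ∩ A` and `Future(x) ∩ A` are finite; (c) `C` contains an infinite
antichain. -/
def IsWellBehavedCausalSet (C : Type) [PartialOrder C] : Prop :=
  (Countable C ∧ Infinite C) ∧
  (∀ x y : C, (Set.Icc x y).Finite) ∧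
  (∀ Ch : Set C, IsMaxChain (· ≤ ·) Ch → ∀ A : Set C, IsAntichain (· ≤ ·) A →
    A ⊆ ⋃ x ∈ Ch, ({y : C | y ≤ x} ∪ {y : C | x ≤ y})) ∧
  (∀ x : C, ∀ A : Set C, IsAntichain (· ≤ ·) A →
    ({y : C | y ≤ x} ∩ A).Finite ∧ ({y : C | x ≤ y} ∩ A).Finite) ∧
  (∃ A : Set C, IsAntichain (· ≤ ·) A ∧ A.Infinite)

/-- A temporal foliation of a poset `C`, given as a family of slices `X : I → Set C`
indexed by a linearly ordered type `I`. -/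
def IsTemporalFoliation {C : Type} [PartialOrder C] {I : Type} [LinearOrder I]
    (X : I → Set C) : Prop :=
  (∀ i, (X i).Nonempty) ∧
  (∀ i j : I, i ≠ j → Disjoint (X i) (X j)) ∧
  (⋃ i, X i) = Set.univ ∧
  (∀ i, IsAntichain (· ≤ ·) (X i)) ∧
  (∀ i j : I, i < j →
    (∃ x ∈ X i, ∃ y ∈ X j, x < y) ∧ (∀ z ∈ X i, ∀ t ∈ X j, ¬ t ≤ z))

/-- In a well behaved causal set with automorphism `Φ` and a point `x₀`, the set
`Σ` of minimal elements of `{x | x₀ < x ∧ x ≠ Φ^ℓ x₀ for all ℓ > 0}` is a finite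
antichain. -/
theorem minimals_finite_antichain
    {C : Type} [PartialOrder C] (hwb : IsWellBehavedCausalSet C)
    (Φ : Equiv.Perm C) (hΦ : IsCausalAuto Φ) (x₀ : C) :
    ({b ∈ {x : C | x₀ < x ∧ ∀ ℓ : ℤ, 0 < ℓ → x ≠ (Φ ^ ℓ) x₀} |
        ∀ x ∈ {x : C | x₀ < x ∧ ∀ ℓ : ℤ, 0 < ℓ → x ≠ (Φ ^ ℓ) x₀}, ¬ x < b} :
      Set C).Finite ∧
    IsAntichain (· ≤ ·)
      ({b ∈ {x : C | x₀ < x ∧ ∀ ℓ : ℤ, 0 < ℓ → x ≠ (Φ ^ ℓ) x₀} |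
        ∀ x ∈ {x : C | x₀ < x ∧ ∀ ℓ : ℤ, 0 < ℓ → x ≠ (Φ ^ ℓ) x₀}, ¬ x < b} :
      Set C) := by
  set S : Set C := {x : C | x₀ < x ∧ ∀ ℓ : ℤ, 0 < ℓ → x ≠ (Φ ^ ℓ) x₀}
  have anti : IsAntichain (· ≤ ·) ({b ∈ S | ∀ x ∈ S, ¬ x < b} : Set C) :=
    fun a ha b hb hab hle => hb.2 a ha.1 (lt_of_le_of_ne hle hab)
  refine ⟨?_, anti⟩
  obtain ⟨-, -, -, finite_inter, -⟩ := hwb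
  exact (finite_inter x₀ _ anti).2.subset fun b hb => ⟨hb.1.1.le, hb⟩
end
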